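/- Let p, q > 0. The Cauchy transform of the beta distribution satisfies, for every z in the upper half-plane ℂ⁺, the first-order differential equation G̃'_{β_{p,q}}(z) = ((p−1)/z + (q−1)/(z−1))·G̃_{β_{p,q}}(z) − (p+q−1)/(z(z−1)); in particular the map z ↦ G̃_{β_{p,q}}(z) is complex-differentiable on ℂ⁺ with this derivative. -/

import Mathlib

open MeasureTheory Complex Set

/-- The Cauchy transform `∫ 1/(z-x) dμ(x)` of a measure on ℝ. -/
noncomputable def cauchyT (μ : Measure ℝ) (z : ℂ) : ℂ := ∫ x, (z - (x : ℂ))⁻¹ ∂μ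

/-- The Euler beta function `B(p,q) = ∫₀¹ x^(p-1) (1-x)^(q-1) dx`. -/
noncomputable def betaFun (p q : ℝ) : ℝ := ∫ x in Ioo (0:ℝ) 1, x ^ (p - 1) * (1 - x) ^ (q - 1)

/-- The beta distribution `β_{p,q}` on `[0,1]`. -/
noncomputable def betaMeasure (p q : ℝ) : Measure ℝ :=
  volume.withDensity fun x =>
    ENNReal.ofReal ((Ioo (0:ℝ) 1).indicator
      (fun x => x ^ (p - 1) * (1 - x) ^ (q - 1) / betaFun p q) x)

lemma integrableOn_rpow_mul_one_sub_rpow {p q : ℝ} (hp : 0 < p) (hq : 0 < q) :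
    IntegrableOn (fun x : ℝ => x ^ (p - 1) * (1 - x) ^ (q - 1)) (Ioo 0 1) := by
  have h := betaIntegral_convergent (u := p) (v := q) (by simpa) (by simpa)
  rw [intervalIntegrable_iff_integrableOn_Ioo_of_le zero_le_one] at h
  refine IntegrableOn.congr_fun (f := fun x : ℝ => (_ : ℂ).re) h.re (fun x hx => ?_) measurableSet_Ioo
  have h1 : (0 : ℝ) ≤ 1 - x := by linarith [hx.2]
  have h2 : ((x : ℂ) ^ ((p : ℂ) - 1) * (1 - (x : ℂ)) ^ ((q : ℂ) - 1))
      = ((x ^ (p - 1) * (1 - x) ^ (q - 1) : ℝ) : ℂ) := by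
    push_cast [ofReal_cpow hx.1.le, ofReal_cpow h1]
    rfl
  simp only [h2, ofReal_re]

lemma betaFun_pos {p q : ℝ} (hp : 0 < p) (hq : 0 < q) : 0 < betaFun p q := by
  have hpos : ∀ x ∈ Ioo (0 : ℝ) 1, 0 < x ^ (p - 1) * (1 - x) ^ (q - 1) := fun x hx =>
    mul_pos (Real.rpow_pos_of_pos hx.1 _) (Real.rpow_pos_of_pos (by linarith [hx.2]) _)
  rw [betaFun, setIntegral_pos_iff_support_of_nonneg_ae
    (ae_restrict_of_forall_mem measurableSet_Ioo fun x hx => (hpos x hx).le)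
    (integrableOn_rpow_mul_one_sub_rpow hp hq),
    inter_eq_right.mpr fun x hx => Function.mem_support.mpr (hpos x hx).ne']
  simp

lemma isFiniteMeasure_betaMeasure {p q : ℝ} (hp : 0 < p) (hq : 0 < q) :
    IsFiniteMeasure (betaMeasure p q) := by
  refine isFiniteMeasure_withDensity_ofReal (Integrable.hasFiniteIntegral ?_)
  rw [integrable_indicator_iff measurableSet_Ioo]
  exact (integrableOn_rpow_mul_one_sub_rpow hp hq).div_const _

lemma integral_betaMeasure {p q : ℝ} (hp : 0 < p) (hq : 0 < q) (f : ℝ → ℂ) :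
    ∫ x, f x ∂betaMeasure p q = (betaFun p q : ℂ)⁻¹ *
      ∫ x in Ioo (0 : ℝ) 1, ((x ^ (p - 1) * (1 - x) ^ (q - 1) : ℝ) : ℂ) * f x := by
  have hB := betaFun_pos hp hq
  rw [betaMeasure, integral_withDensity_eq_integral_toReal_smul
    (Measurable.indicator (by fun_prop) measurableSet_Ioo).ennreal_ofReal (by simp), ← integral_indicator measurableSet_Ioo, ← integral_const_mul]
  refine integral_congr_ae (Filter.Eventually.of_forall fun x => ?_)
  by_cases hx : x ∈ Ioo (0 : ℝ) 1
  · have h0 : 0 ≤ x ^ (p - 1) * (1 - x) ^ (q - 1) / betaFun p q :=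
      div_nonneg (mul_nonneg (Real.rpow_nonneg hx.1.le _)
        (Real.rpow_nonneg (by linarith [hx.2]) _)) hB.le
    simp only [indicator_of_mem hx, ENNReal.toReal_ofReal h0, real_smul]
    push_cast
    ring
  · simp [indicator_of_notMem hx]

lemma integral_one_betaMeasure {p q : ℝ} (hp : 0 < p) (hq : 0 < q) :
    ∫ _, (1 : ℂ) ∂betaMeasure p q = 1 := by
  simp only [integral_betaMeasure hp hq, mul_one]
  rw [integral_complex_ofReal]
  exact inv_mul_cancel₀ (ofReal_ne_zero.mpr (betaFun_pos hp hq).ne')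

lemma sub_ofReal_ne_zero_of_im_pos {z : ℂ} (hz : 0 < z.im) (x : ℝ) : z - x ≠ 0 := fun h => by
  have := congrArg im h
  simp at this
  exact hz.ne' this

lemma norm_inv_sub_ofReal_le {z : ℂ} {c : ℝ} (hc : 0 < c) (hz : c ≤ z.im) (x : ℝ) :
    ‖(z - x)⁻¹‖ ≤ c⁻¹ := by
  rw [norm_inv]
  refine inv_anti₀ hc (hz.trans ?_)
  simpa using (le_abs_self _).trans (abs_im_le_norm (z - x))

lemma integrable_inv_sub_pow (μ : Measure ℝ) [IsFiniteMeasure μ] {z : ℂ} (hz : 0 < z.im)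
    (n : ℕ) : Integrable (fun x : ℝ => ((z - x)⁻¹) ^ n) μ := by
  refine Integrable.of_bound (by fun_prop) ((z.im)⁻¹ ^ n)
    (Filter.Eventually.of_forall fun x => ?_)
  rw [norm_pow]
  exact pow_le_pow_left₀ (norm_nonneg _) (norm_inv_sub_ofReal_le hz le_rfl x) n

lemma hasDerivAt_cauchyT (μ : Measure ℝ) [IsFiniteMeasure μ] {z : ℂ} (hz : 0 < z.im) :
    HasDerivAt (cauchyT μ) (-∫ x, ((z - (x : ℂ))⁻¹) ^ 2 ∂μ) z := by
  rw [← integral_neg]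
  have hc : 0 < z.im / 2 := by positivity
  refine (hasDerivAt_integral_of_dominated_loc_of_deriv_le
    (F' := fun (w : ℂ) (x : ℝ) => -((w - (x : ℂ))⁻¹) ^ 2)
    (s := {w : ℂ | z.im / 2 < w.im}) (bound := fun _ => (z.im / 2)⁻¹ ^ 2)
    ((isOpen_lt continuous_const continuous_im).mem_nhds (by simpa using hz))
    (Filter.Eventually.of_forall fun w => by fun_prop)
    (by simpa using integrable_inv_sub_pow μ hz 1) (by fun_prop) ?_
    (integrable_const _) ?_).2
  · refine Filter.Eventually.of_forall fun x w hw => ?_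
    rw [norm_neg, norm_pow]
    exact pow_le_pow_left₀ (norm_nonneg _) (norm_inv_sub_ofReal_le hc (le_of_lt hw) x) 2
  · refine Filter.Eventually.of_forall fun x w hw => ?_
    have h := ((hasDerivAt_id w).sub_const (x : ℂ)).inv
      (sub_ofReal_ne_zero_of_im_pos (hc.trans hw) x)
    convert! h using 1
    simp [neg_div]

lemma hasDerivAt_rpow_mul_one_sub_rpow (p q : ℝ) {x : ℝ} (hx : x ∈ Ioo (0 : ℝ) 1) :
    HasDerivAt (fun x : ℝ => x ^ p * (1 - x) ^ q)
      (x ^ (p - 1) * (1 - x) ^ (q - 1) * (p * (1 - x) - q * x)) x := by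
  have h1 : 0 < 1 - x := by linarith [hx.2]
  have h := (Real.hasDerivAt_rpow_const (p := p) (Or.inl hx.1.ne')).mul
    (((hasDerivAt_id x).const_sub 1).rpow_const (p := q) (Or.inl h1.ne'))
  convert! h using 1
  have e1 : x ^ p = x ^ (p - 1) * x := by
    rw [Real.rpow_sub_one hx.1.ne', div_mul_cancel₀ _ hx.1.ne']
  have e2 : (1 - x) ^ q = (1 - x) ^ (q - 1) * (1 - x) := by
    rw [Real.rpow_sub_one h1.ne', div_mul_cancel₀ _ h1.ne']
  simp only [id, e1, e2]
  ring

/-- Integration by parts: the derivative of `x ^ p * (1 - x) ^ q / (z - x)` integrates to `0`. -/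
lemma integral_betaMeasure_by_parts {p q : ℝ} (hp : 0 < p) (hq : 0 < q) {z : ℂ}
    (hz : 0 < z.im) :
    ∫ x : ℝ, ((p * (1 - x) - q * x) * (z - x)⁻¹ + x * (1 - x) * ((z - x)⁻¹) ^ 2)
      ∂betaMeasure p q = 0 := by
  have hne := sub_ofReal_ne_zero_of_im_pos hz
  have hr : Continuous fun x : ℝ => (z - (x : ℂ))⁻¹ := Continuous.inv₀ (by fun_prop) hne
  rw [integral_betaMeasure hp hq, ← integral_Ioc_eq_integral_Ioo,
    ← intervalIntegral.integral_of_le zero_le_one,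
    intervalIntegral.integral_eq_sub_of_hasDerivAt_of_le
      (f := fun x : ℝ => ((x ^ p * (1 - x) ^ q : ℝ) : ℂ) * (z - x)⁻¹) zero_le_one]
  · simp [Real.zero_rpow hp.ne', Real.zero_rpow hq.ne']
  · refine Continuous.continuousOn (Continuous.mul (continuous_ofReal.comp ?_) hr)
    exact (Real.continuous_rpow_const hp.le).mul
      ((Real.continuous_rpow_const hq.le).comp (by fun_prop))
  · intro x hx
    have h := (hasDerivAt_rpow_mul_one_sub_rpow p q hx).ofReal_comp.mul
      (((hasDerivAt_id (x : ℂ)).const_sub z).inv (hne x)).comp_ofReal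
    have e : x ^ p * (1 - x) ^ q = x ^ (p - 1) * (1 - x) ^ (q - 1) * (x * (1 - x)) := by
      have h1 : 1 - x ≠ 0 := by linarith [hx.2]
      rw [Real.rpow_sub_one hx.1.ne', Real.rpow_sub_one h1]
      field_simp [hx.1.ne']
    convert! h using 1
    simp only [id, e, Pi.inv_apply]
    push_cast
    field_simp [hne x]
  · rw [intervalIntegrable_iff_integrableOn_Icc_of_le zero_le_one]
    refine IntegrableOn.mul_continuousOn ?_ (Continuous.continuousOn ?_) isCompact_Icc
    · rw [integrableOn_Icc_iff_integrableOn_Ioo]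
      exact (integrableOn_rpow_mul_one_sub_rpow hp hq).ofReal
    · fun_prop

theorem stmt_9 (p q : ℝ) (hp : 0 < p) (hq : 0 < q)
    (z : ℂ) (hz : 0 < z.im) :
    HasDerivAt (cauchyT (betaMeasure p q))
      ((((p : ℂ) - 1) / z + ((q : ℂ) - 1) / (z - 1)) * cauchyT (betaMeasure p q) z
        - ((p : ℂ) + (q : ℂ) - 1) / (z * (z - 1))) z := by
  have := isFiniteMeasure_betaMeasure hp hq
  have hz0 : z ≠ 0 := by simpa using sub_ofReal_ne_zero_of_im_pos hz 0
  have hz1 : z - 1 ≠ 0 := by simpa using sub_ofReal_ne_zero_of_im_pos hz 1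
  have hparts := integral_betaMeasure_by_parts hp hq hz
  have hexpand : ∀ x : ℝ,
      (p * (1 - x) - q * x) * (z - x)⁻¹ + x * (1 - x) * ((z - (x : ℂ))⁻¹) ^ 2
        = (z * (1 - z)) * ((z - (x : ℂ))⁻¹) ^ 2
          + (p - (p + q) * z + 2 * z - 1) * (z - (x : ℂ))⁻¹ + (p + q - 1) * 1 := fun x => by
    field_simp [sub_ofReal_ne_zero_of_im_pos hz x]
    ring
  have h1 : Integrable (fun x : ℝ => (z - (x : ℂ))⁻¹) (betaMeasure p q) := by
    simpa using integrable_inv_sub_pow (betaMeasure p q) hz 1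
  have h2 := integrable_inv_sub_pow (betaMeasure p q) hz 2
  simp only [hexpand] at hparts
  rw [integral_add (by fun_prop) (by fun_prop), integral_add (h2.const_mul _) (h1.const_mul _), integral_const_mul, integral_const_mul,
    integral_const_mul, integral_one_betaMeasure hp hq] at hparts
  convert! hasDerivAt_cauchyT (betaMeasure p q) hz using 1
  rw [cauchyT]
  generalize ∫ x : ℝ, (z - (x : ℂ))⁻¹ ∂betaMeasure p q = G at hparts ⊢
  generalize ∫ x : ℝ, ((z - (x : ℂ))⁻¹) ^ 2 ∂betaMeasure p q = G₂ at hparts ⊢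
  field_simp
  linear_combination -hparts
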